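/- Let $p \geq 7$ be a prime, let $\Xi \in \mathbb{F}_p$ be a quadratic non-residue, let $H$ be a subgroup of $\mathbb{F}_p^{\times}$ with $-1 \in H$ and index $d = [\mathbb{F}_p^{\times} : H] \geq 3$, and set $G_H = \{g \in G : \det g \in H\}$, where $G$ is the set of matrices $\begin{pmatrix}\alpha & \Xi\beta \\ \beta & \alpha\end{pmatrix}$ and $\begin{pmatrix}\alpha & \Xi\beta \\ -\beta & -\alpha\end{pmatrix}$ with $(\alpha,\beta) \neq (0,0)$. Then two nonzero row vectors $(x,y)$ and $(x',y')$ in $\mathbb{F}_p^2 \setminus \{(0,0)\}$ lie in the same orbit of the right multiplication action of $G_H$ if and only if $x^2 - \Xi^{-1}y^2$ and $x'^2 - \Xi^{-1}y'^2$ lie in the same coset of $H$ in $\mathbb{F}_p^{\times}$. In particular, this action has exactly $d$ orbits, namely the sets $\mathcal{O}_a = \{(x,y) : x^2 - \Xi^{-1}y^2 \in aH\}$ for $a$ running through $\mathbb{F}_p^{\times}/H$. -/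

import Mathlib

lemma aux_surj {p : ℕ} [Fact p.Prime] (hp2 : p ≠ 2) (c a : ZMod p) (hc : c ≠ 0) :
    ∃ x y : ZMod p, x ^ 2 - c * y ^ 2 = a := by
  open Polynomial in
  obtain ⟨x, y, h⟩ := FiniteField.exists_root_sum_quadratic (R := ZMod p)
    (f := C 1 * X ^ 2 + C 0 * X + C (-a)) (g := C (-c) * X ^ 2 + C 0 * X + C 0)
    (degree_quadratic one_ne_zero) (degree_quadratic (neg_ne_zero.mpr hc))
    (by rw [ZMod.card]; exact Nat.odd_iff.mp ((Fact.out : p.Prime).odd_of_ne_two hp2))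
  refine ⟨x, y, ?_⟩
  simp at h
  linear_combination h

lemma aux_aniso {p : ℕ} [Fact p.Prime] (Ξ : ZMod p) (hΞ : ¬ ∃ z : ZMod p, z ^ 2 = Ξ)
    (v : ZMod p × ZMod p) (hv : v ≠ (0, 0)) : v.1 ^ 2 - Ξ⁻¹ * v.2 ^ 2 ≠ 0 := by
  obtain ⟨x, y⟩ := v
  have h0 : Ξ ≠ 0 := fun h => hΞ ⟨0, by simp [h]⟩
  intro h
  simp only at h
  have h1 : y ^ 2 = Ξ * x ^ 2 := by
    field_simp at h
    linear_combination -h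
  by_cases hx : x = 0
  · subst hx
    have : y = 0 := by simpa using h1
    exact hv (by simp [this])
  · exact hΞ ⟨y / x, by rw [div_pow, h1]; field_simp⟩

lemma aux_orbit {p : ℕ} [Fact p.Prime] (Ξ : ZMod p) (hΞ : ¬ ∃ z : ZMod p, z ^ 2 = Ξ)
    (H : Subgroup (ZMod p)ˣ) (hH : (-1 : (ZMod p)ˣ) ∈ H)
    (v w : ZMod p × ZMod p) (hv : v ≠ (0, 0)) :
    (∃ g ∈ {g : Matrix (Fin 2) (Fin 2) (ZMod p) | (∃ α β : ZMod p, ¬(α = 0 ∧ β = 0) ∧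
        (g = !![α, Ξ * β; β, α] ∨ g = !![α, Ξ * β; -β, -α])) ∧
      (∃ h ∈ H, ((h : (ZMod p)ˣ) : ZMod p) = Matrix.det g)},
        Matrix.vecMul ![v.1, v.2] g = ![w.1, w.2]) ↔
        (∃ h ∈ H, w.1 ^ 2 - Ξ⁻¹ * w.2 ^ 2
          = ((h : (ZMod p)ˣ) : ZMod p) * (v.1 ^ 2 - Ξ⁻¹ * v.2 ^ 2)) := by
  have hq := aux_aniso Ξ hΞ v hv
  obtain ⟨x, y⟩ := v
  obtain ⟨x', y'⟩ := w
  have h0 : Ξ ≠ 0 := fun h => hΞ ⟨0, by simp [h]⟩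
  simp only at hq ⊢
  constructor
  · rintro ⟨g, ⟨⟨α, β, -, hg⟩, h, hh, hd⟩, hvw⟩
    have e0 := congrFun hvw 0
    have e1 := congrFun hvw 1
    rcases hg with rfl | rfl
    · simp [Matrix.vecMul, dotProduct, Fin.sum_univ_two, Matrix.det_fin_two] at e0 e1 hd
      refine ⟨h, hh, ?_⟩
      rw [hd, ← e0, ← e1]
      field_simp
      ring
    · simp [Matrix.vecMul, dotProduct, Fin.sum_univ_two, Matrix.det_fin_two] at e0 e1 hd
      refine ⟨-1 * h, H.mul_mem hH hh, ?_⟩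
      rw [Units.val_mul, hd, ← e0, ← e1]
      push_cast
      field_simp
      ring
  · rintro ⟨h, hh, e⟩
    have hN : Ξ * x ^ 2 - y ^ 2 ≠ 0 := by
      intro h'
      apply hq
      field_simp
      linear_combination h'
    have e' : Ξ * x' ^ 2 - y' ^ 2 = h * (Ξ * x ^ 2 - y ^ 2) := by
      field_simp at e
      linear_combination e
    obtain ⟨N, hNd⟩ : ∃ N, N = Ξ * x ^ 2 - y ^ 2 := ⟨_, rfl⟩
    rw [← hNd] at hN e'
    have hdet : ((h : (ZMod p)ˣ) : ZMod p) = ((Ξ * x * x' - y * y') / N) ^ 2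
        - Ξ * ((x * y' - y * x') / N) ^ 2 := by
      field_simp
      linear_combination (-N) * e' + (Ξ * x' ^ 2 - y' ^ 2) * hNd
    refine ⟨!![(Ξ * x * x' - y * y') / N, Ξ * ((x * y' - y * x') / N);
      (x * y' - y * x') / N, (Ξ * x * x' - y * y') / N],
      ⟨⟨_, _, ?_, Or.inl rfl⟩, h, hh, ?_⟩, ?_⟩
    · rintro ⟨ha, hb⟩
      rw [ha, hb] at hdet
      exact h.ne_zero (by simpa using hdet)
    · rw [hdet, Matrix.det_fin_two]
      simp
      ring
    · ext i
      fin_cases i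
      · simp [Matrix.vecMul, dotProduct, Fin.sum_univ_two]
        field_simp
        rw [hNd]
        ring
      · simp [Matrix.vecMul, dotProduct, Fin.sum_univ_two]
        field_simp
        rw [hNd]
        ring

/-- Orbits of the right action of `G_H` on nonzero row vectors of `𝔽_p²`: two nonzero
vectors lie in the same orbit iff the values of `x² - Ξ⁻¹ y²` at them lie in the same
coset of `H`; in particular there are exactly `d` orbits, namely the sets `𝒪_a`. -/
theorem cartan_GH_orbits (p : ℕ) (hp : p.Prime) (hp7 : 7 ≤ p)
    (Ξ : ZMod p) (hΞ : ¬ ∃ z : ZMod p, z ^ 2 = Ξ)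
    (H : Subgroup (ZMod p)ˣ) (hH : (-1 : (ZMod p)ˣ) ∈ H)
    (d : ℕ) (hd : d = H.index) (hd3 : 3 ≤ d)
    (GH : Set (Matrix (Fin 2) (Fin 2) (ZMod p)))
    (hGH : GH = {g | (∃ α β : ZMod p, ¬(α = 0 ∧ β = 0) ∧
        (g = !![α, Ξ * β; β, α] ∨ g = !![α, Ξ * β; -β, -α])) ∧
      (∃ h ∈ H, ((h : (ZMod p)ˣ) : ZMod p) = Matrix.det g)}) :
    -- same orbit iff same coset of `H`
    (∀ v w : ZMod p × ZMod p, v ≠ (0, 0) → w ≠ (0, 0) →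
      ((∃ g ∈ GH, Matrix.vecMul ![v.1, v.2] g = ![w.1, w.2]) ↔
        (∃ h ∈ H, w.1 ^ 2 - Ξ⁻¹ * w.2 ^ 2
          = ((h : (ZMod p)ˣ) : ZMod p) * (v.1 ^ 2 - Ξ⁻¹ * v.2 ^ 2)))) ∧
    -- the orbits are exactly the sets `𝒪_a`, `a ∈ 𝔽_p^×/H`
    ({O : Set (ZMod p × ZMod p) | ∃ v : ZMod p × ZMod p, v ≠ (0, 0) ∧
        O = {w | ∃ g ∈ GH, Matrix.vecMul ![v.1, v.2] g = ![w.1, w.2]}}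
      = {O | ∃ a : (ZMod p)ˣ,
        O = {w | ∃ h ∈ H, ((a * h : (ZMod p)ˣ) : ZMod p) = w.1 ^ 2 - Ξ⁻¹ * w.2 ^ 2}}) ∧
    -- there are exactly `d` orbits
    {O : Set (ZMod p × ZMod p) | ∃ v : ZMod p × ZMod p, v ≠ (0, 0) ∧
        O = {w | ∃ g ∈ GH, Matrix.vecMul ![v.1, v.2] g = ![w.1, w.2]}}.ncard = d := by
  haveI : Fact p.Prime := ⟨hp⟩
  have h0 : Ξ ≠ 0 := fun h => hΞ ⟨0, by simp [h]⟩
  have key := aux_orbit Ξ hΞ H hH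
  rw [← hGH] at key
  have surj : ∀ a : (ZMod p)ˣ, ∃ v : ZMod p × ZMod p, v ≠ (0, 0) ∧
      v.1 ^ 2 - Ξ⁻¹ * v.2 ^ 2 = a := by
    intro a
    obtain ⟨x, y, hxy⟩ := aux_surj (by omega : p ≠ 2) Ξ⁻¹ (a : ZMod p) (inv_ne_zero h0)
    refine ⟨(x, y), ?_, hxy⟩
    intro h
    obtain ⟨rfl, rfl⟩ := Prod.mk.inj h
    exact a.ne_zero (by rw [← hxy]; simp)
  have orb : ∀ (a : (ZMod p)ˣ) (v : ZMod p × ZMod p), v ≠ (0, 0) →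
      v.1 ^ 2 - Ξ⁻¹ * v.2 ^ 2 = a →
      {w : ZMod p × ZMod p | ∃ g ∈ GH, Matrix.vecMul ![v.1, v.2] g = ![w.1, w.2]} =
      {w | ∃ h ∈ H, ((a * h : (ZMod p)ˣ) : ZMod p) = w.1 ^ 2 - Ξ⁻¹ * w.2 ^ 2} := by
    intro a v hv hva
    ext w
    simp only [Set.mem_ofPred_eq]
    rw [key v w hv, hva]
    refine exists_congr fun h => and_congr_right fun _ => ?_
    rw [Units.val_mul, mul_comm (a : ZMod p), eq_comm]
  have sets : {O : Set (ZMod p × ZMod p) | ∃ v : ZMod p × ZMod p, v ≠ (0, 0) ∧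
        O = {w | ∃ g ∈ GH, Matrix.vecMul ![v.1, v.2] g = ![w.1, w.2]}}
      = {O | ∃ a : (ZMod p)ˣ,
        O = {w | ∃ h ∈ H, ((a * h : (ZMod p)ˣ) : ZMod p) = w.1 ^ 2 - Ξ⁻¹ * w.2 ^ 2}} := by
    ext O
    constructor
    · rintro ⟨v, hv, rfl⟩
      exact ⟨Units.mk0 _ (aux_aniso Ξ hΞ v hv), orb _ v hv rfl⟩
    · rintro ⟨a, rfl⟩
      obtain ⟨v, hv, hva⟩ := surj a
      exact ⟨v, hv, (orb a v hv hva).symm⟩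
  refine ⟨fun v w hv _ => key v w hv, sets, ?_⟩
  rw [sets, hd]
  let F : (ZMod p)ˣ ⧸ H → Set (ZMod p × ZMod p) := fun q =>
    {w | ∃ u : (ZMod p)ˣ, (u : (ZMod p)ˣ ⧸ H) = q ∧ (u : ZMod p) = w.1 ^ 2 - Ξ⁻¹ * w.2 ^ 2}
  have hF : ∀ a : (ZMod p)ˣ, F (a : (ZMod p)ˣ ⧸ H) =
      {w | ∃ h ∈ H, ((a * h : (ZMod p)ˣ) : ZMod p) = w.1 ^ 2 - Ξ⁻¹ * w.2 ^ 2} := by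
    intro a
    ext w
    constructor
    · rintro ⟨u, hu, e⟩
      exact ⟨a⁻¹ * u, QuotientGroup.eq.mp hu.symm, by rw [mul_inv_cancel_left]; exact e⟩
    · rintro ⟨h, hh, e⟩
      exact ⟨a * h, (QuotientGroup.eq.mpr (by simpa using hh)).symm, e⟩
  have hinj : Function.Injective F := by
    intro q r hqr
    induction q using QuotientGroup.induction_on with
    | H a =>
      obtain ⟨v, -, hva⟩ := surj a
      have hm : v ∈ F (a : (ZMod p)ˣ ⧸ H) := ⟨a, rfl, hva.symm⟩
      rw [hqr] at hm
      obtain ⟨u, hu, e⟩ := hm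
      rw [hva] at e
      rw [← hu, Units.ext e]
  have hr : {O | ∃ a : (ZMod p)ˣ,
        O = {w | ∃ h ∈ H, ((a * h : (ZMod p)ˣ) : ZMod p) = w.1 ^ 2 - Ξ⁻¹ * w.2 ^ 2}}
      = Set.range F := by
    ext O
    constructor
    · rintro ⟨a, rfl⟩
      exact ⟨a, hF a⟩
    · rintro ⟨q, rfl⟩
      induction q using QuotientGroup.induction_on with
      | H a => exact ⟨a, hF a⟩
  rw [hr, ← Nat.card_coe_set_eq, Nat.card_range_of_injective hinj]
  rfl
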